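/- arXiv:1404.7189 — 2 statements merged into one kernel-verified Lean document; each statement's English description precedes it below -/
import Mathlib

section
/- Fix $p\in(0,1)$ and define $f:(-\infty,1]\to\mathbb{R}$ by $f(x)=(2-x)^{2-x} p (1-p)^{1-x}(1-x)^{x-1}$ (with $0^0=1$). Then $f$ is continuous on $(-\infty,1]$, differentiable on $(-\infty,1)$, increasing on $(-\infty, 2-1/p]$, and decreasing on $[2-1/p, 1]$. -/
open Real Set

noncomputable def paperF (p x : ℝ) : ℝ :=
  (2 - x) ^ (2 - x) * p * (1 - p) ^ (1 - x) * (1 - x) ^ (x - 1)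

/-- The logarithm of `paperF p x / p`. -/
noncomputable def logPaperF (p x : ℝ) : ℝ :=
  (2 - x) * log (2 - x) + (1 - x) * log (1 - p) - (1 - x) * log (1 - x)

lemma rpow_self_eq_exp {y : ℝ} (hy : 0 ≤ y) : y ^ y = exp (y * log y) := by
  rcases hy.eq_or_lt with rfl | hy
  · simp
  · rw [rpow_def_of_pos hy, mul_comm]

lemma paperF_eq_mul_exp {p x : ℝ} (hp : p < 1) (hx : x ≤ 1) :
    paperF p x = p * exp (logPaperF p x) := by
  have hneg : (1 - x) ^ (x - 1) = exp (-((1 - x) * log (1 - x))) := by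
    rw [← neg_sub 1 x, rpow_neg (by linarith), rpow_self_eq_exp (by linarith), exp_neg]
  rw [paperF, logPaperF, hneg, rpow_self_eq_exp (by linarith),
    rpow_def_of_pos (by linarith : 0 < 1 - p), sub_eq_add_neg _ ((1 - x) * log (1 - x)),
    exp_add, exp_add, mul_comm (log (1 - p))]
  ring

lemma continuous_logPaperF (p : ℝ) : Continuous (logPaperF p) := by
  have h (a : ℝ) : Continuous fun x : ℝ => (a - x) * log (a - x) :=
    continuous_mul_log.comp (continuous_const.sub continuous_id)
  exact ((h 2).add (by fun_prop)).sub (h 1)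

lemma hasDerivAt_logPaperF (p : ℝ) {x : ℝ} (hx : x < 1) :
    HasDerivAt (logPaperF p) (log (1 - x) - log (2 - x) - log (1 - p)) x := by
  have h (a : ℝ) (ha : a - x ≠ 0) :
      HasDerivAt (fun x : ℝ => (a - x) * log (a - x)) (-(log (a - x) + 1)) x :=
    ((hasDerivAt_mul_log ha).comp x ((hasDerivAt_id x).const_sub a)).congr_deriv (by ring)
  have hlin : HasDerivAt (fun x : ℝ => (1 - x) * log (1 - p)) (-log (1 - p)) x := by
    simpa using ((hasDerivAt_id x).const_sub 1).mul_const (log (1 - p))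
  exact (((h 2 (by linarith)).add hlin).sub (h 1 (by linarith))).congr_deriv (by ring)

lemma monotoneOn_logPaperF {p : ℝ} (hp : p ∈ Ioo (0 : ℝ) 1) :
    MonotoneOn (logPaperF p) (Iic (2 - 1 / p)) := by
  obtain ⟨hp0, hp1⟩ := hp
  have hone : 1 < 1 / p := (one_lt_div hp0).2 hp1
  refine monotoneOn_of_deriv_nonneg (convex_Iic _) (continuous_logPaperF p).continuousOn
    ?_ ?_ <;> rw [interior_Iic] <;> intro x hx <;> rw [mem_Iio] at hx
  · exact (hasDerivAt_logPaperF p (by linarith)).differentiableAt.differentiableWithinAt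
  · rw [(hasDerivAt_logPaperF p (by linarith)).deriv, sub_sub,
      ← log_mul (by linarith) (by linarith), sub_nonneg]
    refine log_le_log (mul_pos (by linarith) (by linarith)) ?_
    have := (div_le_iff₀ hp0).1 (by linarith : 1 / p ≤ 2 - x)
    linarith

lemma antitoneOn_logPaperF {p : ℝ} (hp : p ∈ Ioo (0 : ℝ) 1) :
    AntitoneOn (logPaperF p) (Icc (2 - 1 / p) 1) := by
  obtain ⟨hp0, hp1⟩ := hp
  refine antitoneOn_of_deriv_nonpos (convex_Icc _ _) (continuous_logPaperF p).continuousOn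
    ?_ ?_ <;> rw [interior_Icc] <;> rintro x ⟨hx, hx1⟩
  · exact (hasDerivAt_logPaperF p hx1).differentiableAt.differentiableWithinAt
  · rw [(hasDerivAt_logPaperF p hx1).deriv, sub_sub,
      ← log_mul (by linarith) (by linarith), sub_nonpos]
    refine log_le_log (by linarith) ?_
    have := (le_div_iff₀ hp0).1 (by linarith : 2 - x ≤ 1 / p)
    linarith

theorem stmt_2 (p : ℝ) (hp : p ∈ Set.Ioo (0 : ℝ) 1) :
    ContinuousOn (paperF p) (Set.Iic 1) ∧
    DifferentiableOn ℝ (paperF p) (Set.Iio 1) ∧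
    MonotoneOn (paperF p) (Set.Iic (2 - 1 / p)) ∧
    AntitoneOn (paperF p) (Set.Icc (2 - 1 / p) 1) := by
  have heq : EqOn (paperF p) (fun x => p * exp (logPaperF p x)) (Iic 1) :=
    fun x hx => paperF_eq_mul_exp hp.2 hx
  have hmono : Monotone fun y : ℝ => p * exp y := exp_monotone.const_mul hp.1.le
  have hle : 2 - 1 / p ≤ 1 := by
    have := (one_lt_div hp.1).2 hp.2
    linarith
  refine ⟨?_, ?_, ?_, ?_⟩
  · exact (continuous_const.mul (continuous_logPaperF p).rexp).continuousOn.congr heq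
  · refine DifferentiableOn.congr (fun x hx => ?_) (heq.mono Iio_subset_Iic_self)
    exact ((hasDerivAt_logPaperF p hx).exp.const_mul p).differentiableAt.differentiableWithinAt
  · exact (hmono.comp_monotoneOn (monotoneOn_logPaperF hp)).congr
      (heq.mono (Iic_subset_Iic.2 hle)).symm
  · exact (hmono.comp_antitoneOn (antitoneOn_logPaperF hp)).congr
      (heq.mono Icc_subset_Iic_self).symm
end

section
/- Let $\eta, c$ be positive reals with $\eta\ge 4e^p/p$ and $c\le p\eta$, where $p\in(0,1)$ is fixed, and let $f(x)=(2-x)^{2-x}p(1-p)^{1-x}(1-x)^{x-1}$ and $\Upsilon(x)=x-1-\log x$ for $0<x\le 1$, $\Upsilon(x)=0$ for $x>1$. Then $-c\,\Upsilon(1/c)+c\log f(2-\eta/c) < \max\{\eta(1-p)\log(1-p^3),\,-0.15\,p\eta\}-1$. -/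
open Real Set

noncomputable def upsilon (x : ℝ) : ℝ := if x ≤ 1 then x - 1 - Real.log x else 0

theorem mul_log_sub_log_le {a b : ℝ} (ha : 0 < a) (hb : 0 < b) :
    a * (log b - log a) ≤ b - a := by
  have h := log_le_sub_one_of_pos (div_pos hb ha)
  rw [log_div hb.ne' ha.ne'] at h
  calc a * (log b - log a) ≤ a * (b / a - 1) := mul_le_mul_of_nonneg_left h ha.le
    _ = b - a := by field_simp

theorem mul_log_paperF {p η c : ℝ} (hp0 : 0 < p) (hp1 : p < 1) (hc : 0 < c) (hcη : c < η) :
    c * log (paperF p (2 - η / c)) =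
      c * (log (p * η) - log c) + (η - c) * (log ((1 - p) * η) - log (η - c)) := by
  have hη : 0 < η := hc.trans hcη
  have hr : 0 < η / c := div_pos hη hc
  have hd : 0 < η - c := sub_pos.2 hcη
  have hq : 0 < 1 - p := sub_pos.2 hp1
  have e1 : 2 - (2 - η / c) = η / c := by ring
  have e2 : 1 - (2 - η / c) = (η - c) / c := by field_simp; ring
  have e3 : 2 - η / c - 1 = -((η - c) / c) := by field_simp; ring
  have hs : 0 < (η - c) / c := div_pos hd hc
  have h1 := rpow_pos_of_pos hr (η / c)
  have h2 := rpow_pos_of_pos hq ((η - c) / c)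
  have h3 := rpow_pos_of_pos hs (-((η - c) / c))
  rw [paperF, e1, e2, e3, log_mul (by positivity) h3.ne', log_mul (by positivity) h2.ne',
    log_mul h1.ne' hp0.ne', log_rpow hr, log_rpow hq, log_rpow hs, log_div hη.ne' hc.ne',
    log_div hd.ne' hc.ne', log_mul hp0.ne' hη.ne', log_mul hq.ne' hη.ne']
  field_simp
  ring

theorem neg_cube_div_le_one_sub_mul_log {p : ℝ} (hp0 : 0 < p) (hp1 : p < 1) :
    -(p ^ 3 / (1 + p + p ^ 2)) ≤ (1 - p) * log (1 - p ^ 3) := by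
  have hq : 0 < 1 - p := sub_pos.2 hp1
  have hk : 0 < 1 + p + p ^ 2 := by positivity
  have e : 1 - p ^ 3 = (1 - p) * (1 + p + p ^ 2) := by ring
  have hx : 0 < 1 - p ^ 3 := e ▸ mul_pos hq hk
  have h := mul_le_mul_of_nonneg_left (one_sub_inv_le_log_of_pos hx) hq.le
  refine le_trans (le_of_eq ?_) h
  rw [e]
  field_simp
  ring

theorem exp_mul_one_sub_lt {p : ℝ} (hp0 : 0 < p) (hp1 : p < 1) :
    exp p * (1 - p) < 1 - p ^ 3 / (1 + p + p ^ 2) := by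
  have hk : 0 < 1 + p + p ^ 2 := by positivity
  have hhalf : 1 - p / 2 ≤ exp (-(p / 2)) := by
    have := add_one_le_exp (-(p / 2)); linarith
  have hsq : (1 - p / 2) ^ 2 ≤ exp (-p) := by
    calc (1 - p / 2) ^ 2 ≤ exp (-(p / 2)) ^ 2 := pow_le_pow_left₀ (by linarith) hhalf 2
      _ = exp (-p) := by rw [← exp_nat_mul]; congr 1; push_cast; ring
  have hB : 0 < 1 - p ^ 3 / (1 + p + p ^ 2) := by
    rw [sub_pos, div_lt_one hk]; nlinarith [pow_lt_one₀ hp0.le hp1 (n := 3) (by norm_num)]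
  have key : 1 - p < (1 - p ^ 3 / (1 + p + p ^ 2)) * (1 - p / 2) ^ 2 := by
    have e : (1 - p ^ 3 / (1 + p + p ^ 2)) * (1 - p / 2) ^ 2 - (1 - p) =
        p ^ 2 * (1 - 3 * p + 5 * p ^ 2 - p ^ 3) / (4 * (1 + p + p ^ 2)) := by
      field_simp; ring
    have : 0 < 1 - 3 * p + 5 * p ^ 2 - p ^ 3 := by
      nlinarith [sq_nonneg (p - 3 / 8), mul_pos (pow_pos hp0 2) (sub_pos.2 hp1)]
    have : 0 < p ^ 2 * (1 - 3 * p + 5 * p ^ 2 - p ^ 3) / (4 * (1 + p + p ^ 2)) := by positivity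
    linarith
  have h := key.trans_le (mul_le_mul_of_nonneg_left hsq hB.le)
  have h' := mul_lt_mul_of_pos_left h (exp_pos p)
  have e : exp p * ((1 - p ^ 3 / (1 + p + p ^ 2)) * exp (-p)) = 1 - p ^ 3 / (1 + p + p ^ 2) := by
    rw [exp_neg]; field_simp
  linarith

theorem stmt_12 (p η c : ℝ) (hp : p ∈ Set.Ioo (0 : ℝ) 1)
    (hη : 4 * Real.exp p / p ≤ η) (hc : 0 < c) (hcη : c ≤ p * η) :
    -c * upsilon (1 / c) + c * Real.log (paperF p (2 - η / c)) <
      max (η * (1 - p) * Real.log (1 - p ^ 3)) (-0.15 * p * η) - 1 := by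
  obtain ⟨hp0, hp1⟩ := hp
  have hq : 0 < 1 - p := sub_pos.2 hp1
  have hη0 : 0 < η := lt_of_lt_of_le (by positivity) hη
  have hpη0 : 0 < p * η := mul_pos hp0 hη0
  have hpη : 4 * exp p ≤ p * η := by rwa [div_le_iff₀' hp0] at hη
  have hcη' : c < η := by nlinarith
  have hd : 0 < η - c := sub_pos.2 hcη'
  have hk : 0 < 1 + p + p ^ 2 := by positivity
  have hlog4 : log 4 = 2 * log 2 := by
    rw [show (4 : ℝ) = 2 ^ 2 by norm_num, log_pow]; norm_num
  have hM := mul_le_mul_of_nonneg_left (neg_cube_div_le_one_sub_mul_log hp0 hp1) hη0.le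
  have hmax := le_max_left (η * (1 - p) * log (1 - p ^ 3)) (-0.15 * p * η)
  rw [mul_log_paperF hp0 hp1 hc hcη']
  suffices h : -c * upsilon (1 / c) + (c * (log (p * η) - log c) +
      (η - c) * (log ((1 - p) * η) - log (η - c))) < η * -(p ^ 3 / (1 + p + p ^ 2)) - 1 by
    linarith
  rcases le_or_gt 1 c with h1 | h1
  · have hu : -c * upsilon (1 / c) = -1 + c - c * log c := by
      rw [upsilon, if_pos ((div_le_one hc).2 h1), one_div, log_inv]
      field_simp
      ring
    have hl : 2 * log 2 + p ≤ log (p * η) := by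
      have h := log_le_log (by positivity) hpη
      rwa [log_mul (by norm_num) (exp_pos p).ne', log_exp, hlog4] at h
    have ha := mul_log_sub_log_le hc (half_pos hpη0)
    have hb := mul_log_sub_log_le hd (mul_pos (exp_pos p) (mul_pos hq hη0))
    rw [log_div hpη0.ne' (by norm_num)] at ha
    rw [log_mul (exp_pos p).ne' (mul_pos hq hη0).ne', log_exp] at hb
    have hl' := mul_le_mul_of_nonneg_left hl hc.le
    have he := mul_lt_mul_of_pos_left (exp_mul_one_sub_lt hp0 hp1) hη0
    rw [hu]
    linarith
  · have hu : upsilon (1 / c) = 0 := by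
      rw [upsilon, if_neg (not_le.2 ((one_lt_div hc).2 h1))]
    have ha := mul_log_sub_log_le hc (show 0 < p * η / 4 by positivity)
    have hb := mul_log_sub_log_le hd (mul_pos hq hη0)
    rw [log_div hpη0.ne' (by norm_num), hlog4] at ha
    have hl2 : c * log 2 ≤ log 2 := mul_le_of_le_one_left (log_nonneg (by norm_num)) h1.le
    have hexp : 4 * (1 + p) ≤ p * η := by linarith [add_one_le_exp p]
    have hfrac : 3 / 4 ≤ (1 + p) * (3 / 4 - p ^ 2 / (1 + p + p ^ 2)) := by
      have e : (1 + p) * (3 / 4 - p ^ 2 / (1 + p + p ^ 2)) - 3 / 4 =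
          p * (3 - p - p ^ 2) / (4 * (1 + p + p ^ 2)) := by
        field_simp; ring
      have : 0 ≤ 3 - p - p ^ 2 := by nlinarith
      have : 0 ≤ p * (3 - p - p ^ 2) / (4 * (1 + p + p ^ 2)) := by positivity
      linarith
    have hpos : 0 ≤ 3 / 4 - p ^ 2 / (1 + p + p ^ 2) := by
      by_contra! h
      nlinarith
    have hprod := mul_le_mul_of_nonneg_right hexp hpos
    have e : p * η * (3 / 4 - p ^ 2 / (1 + p + p ^ 2)) =
        3 / 4 * (p * η) - η * (p ^ 3 / (1 + p + p ^ 2)) := by ring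
    have hlog2 := log_two_lt_d9
    rw [hu]
    linarith
end
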